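/- arXiv:2410.17678 — 4 statements merged into one kernel-verified Lean document; each statement's English description precedes it below -/
import Mathlib

section
/- For every integer m ≥ 1 and every tree T in the family 𝒯_m, the diameter of T is at least 4(m−1). -/
namespace CopsRobber

open SimpleGraph

/-- A strategy for `d` cops on vertex set `V`: initial positions, together with a move
function taking the list of observations made so far (most recent first; the observation in a
round is `some r` if the robber, located at `r`, was visible to the cops at the start of that
round, and `none` if he was invisible) and the current cop positions, and returning the cops'
new positions. -/
structure CopStrategy (V : Type) (d : ℕ) where
  init : Fin d → V
  move : List (Option V) → (Fin d → V) → Fin d → V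

/-- A strategy for the omniscient robber against `d` cops: a starting vertex chosen after
seeing the cops' initial positions, and a move function which may depend on the entire history
of the game (the list of past (cop positions, robber position) states, most recent first),
the cops' new positions, and the robber's current position. -/
structure RobberStrategy (V : Type) (d : ℕ) where
  init : (Fin d → V) → V
  move : List ((Fin d → V) × V) → (Fin d → V) → V → V

/-- A cop strategy is legal if every cop always stays put or moves along an edge of `G`. -/
def CopStrategy.Legal {V : Type} (G : SimpleGraph V) {d : ℕ} (S : CopStrategy V d) : Prop :=
  ∀ h p i, S.move h p i = p i ∨ G.Adj (p i) (S.move h p i)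

/-- A robber strategy is legal if the robber always stays put or moves along an edge of `G`. -/
def RobberStrategy.Legal {V : Type} (G : SimpleGraph V) {d : ℕ} (R : RobberStrategy V d) :
    Prop :=
  ∀ h c r, R.move h c r = r ∨ G.Adj r (R.move h c r)

open Classical in
/-- The cops' observation: the robber's position if he is visible, `none` otherwise. -/
noncomputable def observe {V : Type} {d : ℕ} (vis : (Fin d → V) → V → Prop)
    (c : Fin d → V) (r : V) : Option V :=
  if vis c r then some r else none

/-- The play of the game determined by a cop strategy and a robber strategy, with visibility
predicate `vis`: at each stage we record the current (cop positions, robber position) together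
with the list of past observations and the list of past states. In each round the cops observe
the robber (according to `vis`), move, and then the robber moves. -/
noncomputable def play {V : Type} {d : ℕ} (vis : (Fin d → V) → V → Prop)
    (S : CopStrategy V d) (R : RobberStrategy V d) :
    ℕ → ((Fin d → V) × V) × (List (Option V) × List ((Fin d → V) × V))
  | 0 => ((S.init, R.init S.init), ([], []))
  | n + 1 =>
    let st := play vis S R n
    let c := st.1.1
    let r := st.1.2
    let o := observe vis c r
    let c' := S.move (o :: st.2.1) c
    let r' := R.move ((c, r) :: st.2.2) c' r
    ((c', r'), (o :: st.2.1, (c, r) :: st.2.2))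

/-- The cops' positions at the end of round `n`. -/
noncomputable def copPos {V : Type} {d : ℕ} (vis : (Fin d → V) → V → Prop)
    (S : CopStrategy V d) (R : RobberStrategy V d) (n : ℕ) : Fin d → V :=
  (play vis S R n).1.1

/-- The robber's position at the end of round `n`. -/
noncomputable def robPos {V : Type} {d : ℕ} (vis : (Fin d → V) → V → Prop)
    (S : CopStrategy V d) (R : RobberStrategy V d) (n : ℕ) : V :=
  (play vis S R n).1.2

/-- The cops capture the robber in the given play: at some point (either at the end of a round,
or just after the cops' move within a round) some cop occupies the robber's vertex. -/
def Captures {V : Type} {d : ℕ} (vis : (Fin d → V) → V → Prop)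
    (S : CopStrategy V d) (R : RobberStrategy V d) : Prop :=
  ∃ n i, copPos vis S R n i = robPos vis S R n ∨ copPos vis S R (n + 1) i = robPos vis S R n

/-- A winning strategy for `d` cops on `G` with visibility predicate `vis`: a legal cop
strategy capturing the robber against every legal robber strategy (the robber is omniscient,
so the cops must succeed against all robber behaviours). -/
def WinningCopStrategy {V : Type} (G : SimpleGraph V) {d : ℕ}
    (vis : (Fin d → V) → V → Prop) (S : CopStrategy V d) : Prop :=
  S.Legal G ∧ ∀ R : RobberStrategy V d, R.Legal G → Captures vis S R

/-- The minimum number of cops having a winning strategy on `G`, for the game with visibility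
predicate `vis`. -/
noncomputable def copNumberVis {V : Type} (G : SimpleGraph V)
    (vis : ∀ d : ℕ, (Fin d → V) → V → Prop) : ℕ :=
  sInf {d | ∃ S : CopStrategy V d, WinningCopStrategy G (vis d) S}

/-- The classical cop number `c(G)`: the robber is always visible. -/
noncomputable def copNumber {V : Type} (G : SimpleGraph V) : ℕ :=
  copNumberVis G fun _ _ _ => True

/-- The 0-visibility cop number `c₀(G)`: the robber is never visible. -/
noncomputable def zeroVisCopNumber {V : Type} (G : SimpleGraph V) : ℕ :=
  copNumberVis G fun _ _ _ => False

/-- The `k`-hyperopic cop number `c_{H,k}(G)`: the robber at `r` is invisible exactly when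
every cop `c` satisfies `1 ≤ d(r,c) ≤ k`. -/
noncomputable def hyperopicCopNumber {V : Type} (G : SimpleGraph V) (k : ℕ) : ℕ :=
  copNumberVis G fun _ c r => ¬ ∀ i, 1 ≤ G.dist r (c i) ∧ G.dist r (c i) ≤ k

/-- The graph obtained from three disjoint graphs `T₁, T₂, T₃` and a disjoint copy of the star
`K_{1,3}` with centre `x = Sum.inr 0` and leaves `y₁ = Sum.inr 1`, `y₂ = Sum.inr 2`,
`y₃ = Sum.inr 3`, by joining `yᵢ` to the chosen vertex `aᵢ` of `Tᵢ`. -/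
def attachStar {V1 V2 V3 : Type} (T1 : SimpleGraph V1) (T2 : SimpleGraph V2)
    (T3 : SimpleGraph V3) (a1 : V1) (a2 : V2) (a3 : V3) :
    SimpleGraph ((V1 ⊕ V2 ⊕ V3) ⊕ Fin 4) :=
  SimpleGraph.fromRel fun u v =>
    (∃ x y, T1.Adj x y ∧ u = Sum.inl (Sum.inl x) ∧ v = Sum.inl (Sum.inl y)) ∨
    (∃ x y, T2.Adj x y ∧ u = Sum.inl (Sum.inr (Sum.inl x)) ∧ v = Sum.inl (Sum.inr (Sum.inl y))) ∨
    (∃ x y, T3.Adj x y ∧ u = Sum.inl (Sum.inr (Sum.inr x)) ∧ v = Sum.inl (Sum.inr (Sum.inr y))) ∨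
    (u = Sum.inr 0 ∧ (v = Sum.inr 1 ∨ v = Sum.inr 2 ∨ v = Sum.inr 3)) ∨
    (u = Sum.inr 1 ∧ v = Sum.inl (Sum.inl a1)) ∨
    (u = Sum.inr 2 ∧ v = Sum.inl (Sum.inr (Sum.inl a2))) ∨
    (u = Sum.inr 3 ∧ v = Sum.inl (Sum.inr (Sum.inr a3)))

/-- The families of trees `𝒯ₘ` (up to isomorphism): `𝒯₁ = {K₁}`, and a graph is in `𝒯ₘ₊₁`
iff it is isomorphic to one obtained from three members of `𝒯ₘ` together with a disjoint star
`K_{1,3}` with centre `x` and leaves `y₁, y₂, y₃`, by joining each `yᵢ` to a vertex of the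
`i`-th member. -/
inductive FamilyT : ℕ → ∀ {V : Type}, SimpleGraph V → Prop
  | base {V : Type} (T : SimpleGraph V) :
      Nonempty (T ≃g (⊥ : SimpleGraph (Fin 1))) → FamilyT 1 T
  | step {m : ℕ} {V1 V2 V3 V : Type} {T1 : SimpleGraph V1} {T2 : SimpleGraph V2}
      {T3 : SimpleGraph V3} (h1 : FamilyT m T1) (h2 : FamilyT m T2) (h3 : FamilyT m T3)
      (a1 : V1) (a2 : V2) (a3 : V3) (T : SimpleGraph V)
      (hiso : Nonempty (T ≃g attachStar T1 T2 T3 a1 a2 a3)) : FamilyT (m + 1) T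

/-- An integer potential that changes by at most one along every edge changes by at most the
distance between any two vertices of a connected graph. -/
theorem sub_le_dist_of_adj {V : Type*} {G : SimpleGraph V} (hG : G.Connected) (f : V → ℤ)
    (hf : ∀ u v, G.Adj u v → f v - f u ≤ 1) (u v : V) : f v - f u ≤ G.dist u v := by
  obtain ⟨p, hp⟩ := hG.exists_walk_length_eq_dist u v
  rw [← hp]
  clear hp
  induction p with
  | nil => simp
  | cons h p ih =>
    have := hf _ _ h
    rw [Walk.length_cons]
    push_cast
    lia

section AttachStar

variable {V1 V2 V3 : Type} {T1 : SimpleGraph V1} {T2 : SimpleGraph V2} {T3 : SimpleGraph V3}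
  {a1 : V1} {a2 : V2} {a3 : V3}

theorem attachStar_connected (h1 : T1.Connected) (h2 : T2.Connected) (h3 : T3.Connected) :
    (attachStar T1 T2 T3 a1 a2 a3).Connected := by
  set G := attachStar T1 T2 T3 a1 a2 a3 with hG
  let f1 : T1 →g G := ⟨fun x => .inl (.inl x), fun {x y} h => by simp [hG, attachStar, h, h.ne]⟩
  let f2 : T2 →g G :=
    ⟨fun x => .inl (.inr (.inl x)), fun {x y} h => by simp [hG, attachStar, h, h.ne]⟩
  let f3 : T3 →g G :=
    ⟨fun x => .inl (.inr (.inr x)), fun {x y} h => by simp [hG, attachStar, h, h.ne]⟩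
  have r1 : G.Reachable (.inr 0) (.inr 1) := Adj.reachable (by simp [hG, attachStar])
  have r2 : G.Reachable (.inr 0) (.inr 2) := Adj.reachable (by simp [hG, attachStar])
  have r3 : G.Reachable (.inr 0) (.inr 3) := Adj.reachable (by simp [hG, attachStar])
  have s1 : G.Reachable (.inr 1) (f1 a1) := Adj.reachable (by simp [hG, attachStar, f1])
  have s2 : G.Reachable (.inr 2) (f2 a2) := Adj.reachable (by simp [hG, attachStar, f2])
  have s3 : G.Reachable (.inr 3) (f3 a3) := Adj.reachable (by simp [hG, attachStar, f3])
  rw [connected_iff_exists_forall_reachable]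
  refine ⟨.inr 0, ?_⟩
  rintro ((x | x | x) | i)
  · exact (r1.trans s1).trans ((h1.preconnected a1 x).map f1)
  · exact (r2.trans s2).trans ((h2.preconnected a2 x).map f2)
  · exact (r3.trans s3).trans ((h3.preconnected a3 x).map f3)
  · fin_cases i
    exacts [Reachable.refl _, r1, r2, r3]

theorem dist_add_dist_add_four_le_attachStar_dist (h1 : T1.Connected) (h2 : T2.Connected)
    (h3 : T3.Connected) (b1 : V1) (b2 : V2) :
    T1.dist a1 b1 + T2.dist a2 b2 + 4 ≤
      (attachStar T1 T2 T3 a1 a2 a3).dist (.inl (.inl b1)) (.inl (.inr (.inl b2))) := by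
  let f : (V1 ⊕ V2 ⊕ V3) ⊕ Fin 4 → ℤ :=
    Sum.elim (Sum.elim (fun x => -2 - T1.dist a1 x) (Sum.elim (fun x => 2 + T2.dist a2 x)
      (fun _ => 1))) ![0, -1, 1, 1]
  have key := sub_le_dist_of_adj (attachStar_connected (a1 := a1) (a2 := a2) (a3 := a3) h1 h2 h3)
    f ?_ (.inl (.inl b1)) (.inl (.inr (.inl b2)))
  · simp only [f, Sum.elim_inl, Sum.elim_inr] at key
    lia
  · intro u v huv
    have hs : ∀ {W : Type} {H : SimpleGraph W}, H.Connected → ∀ {a x y : W}, H.Adj x y →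
        H.dist a y ≤ H.dist a x + 1 := fun {W H} hH a x y h => by
      simpa [dist_eq_one_iff_adj.2 h] using hH.dist_triangle (u := a) (v := x) (w := y)
    rw [attachStar, fromRel_adj] at huv
    rcases huv.2 with
        (⟨x, y, h, rfl, rfl⟩ | ⟨x, y, h, rfl, rfl⟩ | ⟨x, y, h, rfl, rfl⟩ | ⟨rfl, rfl | rfl | rfl⟩ |
          ⟨rfl, rfl⟩ | ⟨rfl, rfl⟩ | ⟨rfl, rfl⟩) |
        (⟨x, y, h, rfl, rfl⟩ | ⟨x, y, h, rfl, rfl⟩ | ⟨x, y, h, rfl, rfl⟩ | ⟨rfl, rfl | rfl | rfl⟩ |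
          ⟨rfl, rfl⟩ | ⟨rfl, rfl⟩ | ⟨rfl, rfl⟩)
    all_goals first
      | simp [f]; done
      | have := hs h1 (a := a1) h
        have := hs h1 (a := a1) h.symm
        simp only [f, Sum.elim_inl]
        lia
      | have := hs h2 (a := a2) h
        have := hs h2 (a := a2) h.symm
        simp only [f, Sum.elim_inl, Sum.elim_inr]
        lia

end AttachStar

/-- In a connected graph with two vertices at distance at least `2 * k`, every vertex has some
vertex at distance at least `k`. -/
theorem exists_le_dist_of_two_mul_le_dist {V : Type*} {G : SimpleGraph V} (hG : G.Connected)
    {k : ℕ} {u v : V} (h : 2 * k ≤ G.dist u v) (a : V) : ∃ b, k ≤ G.dist a b := by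
  by_contra! hlt
  have := hG.dist_triangle (u := u) (v := a) (w := v)
  have := hlt u
  have := hlt v
  rw [SimpleGraph.dist_comm (u := u) (v := a)] at *
  lia

theorem dist_map_le {V W : Type*} {G : SimpleGraph V} {H : SimpleGraph W} (hG : G.Connected)
    (f : G →g H) (u v : V) : H.dist (f u) (f v) ≤ G.dist u v := by
  obtain ⟨p, hp⟩ := hG.exists_walk_length_eq_dist u v
  rw [← hp, ← p.length_map f]
  exact dist_le _

theorem FamilyT.connected_and_exists_le_dist {m : ℕ} {V : Type} {T : SimpleGraph V}
    (hT : FamilyT m T) : T.Connected ∧ ∃ u v, 4 * (m - 1) ≤ T.dist u v := by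
  induction hT with
  | base T h =>
    obtain ⟨e⟩ := h
    have hc : (⊥ : SimpleGraph (Fin 1)).Connected := by
      rw [connected_iff_exists_forall_reachable]
      exact ⟨0, fun w => by rw [Subsingleton.elim w 0]⟩
    exact ⟨e.connected_iff.2 hc, e.symm 0, e.symm 0, by simp⟩
  | @step m _ _ _ _ _ _ _ h1 h2 h3 a1 a2 a3 T hiso ih1 ih2 ih3 =>
    obtain ⟨e⟩ := hiso
    obtain ⟨c1, u1, v1, d1⟩ := ih1
    obtain ⟨c2, u2, v2, d2⟩ := ih2
    have c3 := ih3.1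
    obtain ⟨b1, hb1⟩ := exists_le_dist_of_two_mul_le_dist c1 (u := u1) (v := v1)
      (k := 2 * (m - 1)) (by lia) a1
    obtain ⟨b2, hb2⟩ := exists_le_dist_of_two_mul_le_dist c2 (u := u2) (v := v2)
      (k := 2 * (m - 1)) (by lia) a2
    have hd := dist_add_dist_add_four_le_attachStar_dist (a1 := a1) (a2 := a2) (a3 := a3)
      c1 c2 c3 b1 b2
    have hc := e.connected_iff.2 (attachStar_connected (a1 := a1) (a2 := a2) (a3 := a3) c1 c2 c3)
    refine ⟨hc, e.symm (.inl (.inl b1)), e.symm (.inl (.inr (.inl b2))), ?_⟩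
    have hm := dist_map_le hc e.toHom (e.symm (.inl (.inl b1))) (e.symm (.inl (.inr (.inl b2))))
    simp only [RelEmbedding.coe_toRelHom, RelIso.coe_toRelEmbedding, RelIso.apply_symm_apply] at hm
    lia

/-- For every integer `m ≥ 1` and every tree `T` in the family `𝒯ₘ`, the diameter of `T` is
at least `4(m - 1)`. -/
theorem stmt14 (m : ℕ) (hm : 1 ≤ m) {V : Type} [Fintype V] (T : SimpleGraph V)
    (hT : FamilyT m T) : 4 * (m - 1) ≤ T.diam := by
  obtain ⟨hc, u, v, h⟩ := hT.connected_and_exists_le_dist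
  have : Nonempty V := ⟨u⟩
  exact h.trans (dist_le_diam (connected_iff_ediam_ne_top.1 hc))

end CopsRobber
end

section
/- If T is a finite tree, then c_0(T) ≤ ⌊diam(T)/4⌋ + 1. -/
namespace CopsRobber

open SimpleGraph

/-- The vertices on the side of `w` once the edge `uw` has been removed. -/
def branch {V : Type} (G : SimpleGraph V) (u w : V) : Set V :=
  {y | (G.deleteEdges {s(u, w)}).Reachable w y}

section Branch

variable {V : Type} {G : SimpleGraph V} {u w x y z : V}

lemma self_mem_branch : w ∈ branch G u w := Reachable.refl _

lemma notMem_branch (hG : G.IsAcyclic) (h : G.Adj u w) : u ∉ branch G u w := fun hu =>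
  isBridge_iff.1 (isAcyclic_iff_forall_adj_isBridge.1 hG h) hu.symm

/-- The only edge leaving a branch is the one defining it. -/
lemma eq_of_adj_of_notMem_branch (hyz : G.Adj y z) (hy : y ∈ branch G u w)
    (hz : z ∉ branch G u w) : y = w ∧ z = u := by
  by_cases he : s(y, z) = s(u, w)
  · rcases Sym2.eq_iff.1 he with ⟨-, rfl⟩ | h
    · exact absurd self_mem_branch hz
    · exact h
  · exact absurd (hy.trans (Adj.reachable (deleteEdges_adj.2 ⟨hyz, he⟩))) hz

lemma mem_branch_of_walk (p : G.Walk w y) (hu : u ∉ p.support) : y ∈ branch G u w :=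
  (p.toDeleteEdges {s(u, w)} fun e he heq => hu <| by
    rw [Set.mem_singleton_iff] at heq
    exact p.fst_mem_support_of_mem_edges (heq ▸ he)).reachable

lemma exists_mem_branch (hG : G.Connected) (hy : y ≠ u) : ∃ w, G.Adj u w ∧ y ∈ branch G u w := by
  obtain ⟨p, hp⟩ := (hG u y).exists_isPath
  cases p with
  | nil => exact absurd rfl hy
  | cons h q => exact ⟨_, h, mem_branch_of_walk q ((Walk.cons_isPath_iff h q).1 hp).2⟩

lemma branch_subset_branch (hG : G.IsAcyclic) (huw : G.Adj u w) (hwx : G.Adj w x) (hx : x ≠ u) :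
    branch G w x ⊆ branch G u w := by
  have hxB : x ∈ branch G u w := by
    by_contra h
    exact hx (eq_of_adj_of_notMem_branch hwx self_mem_branch h).2
  intro y hy
  induction (reachable_iff_reflTransGen _ _).1 hy with
  | refl => exact hxB
  | tail h1 h2 ih =>
    rename_i b c
    have hb : b ∈ branch G w x := (reachable_iff_reflTransGen _ _).2 h1
    by_contra hc
    obtain ⟨rfl, -⟩ := eq_of_adj_of_notMem_branch (deleteEdges_adj.1 h2).1 (ih hb) hc
    exact notMem_branch hG hwx hb

lemma exists_mem_branch_of_mem_branch
    (hy : y ∈ branch G u w) (hyw : y ≠ w) : ∃ x, G.Adj w x ∧ x ≠ u ∧ y ∈ branch G w x := by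
  obtain ⟨p, hp⟩ := hy.exists_isPath
  cases p with
  | nil => exact absurd rfl hyw
  | @cons _ x _ h q =>
    obtain ⟨hwx, hne⟩ := deleteEdges_adj.1 h
    refine ⟨x, hwx, ?_, ?_⟩
    · rintro rfl
      exact hne Sym2.eq_swap
    · refine mem_branch_of_walk (q.mapLe (deleteEdges_le _)) ?_
      rw [Walk.support_mapLe_eq_support]
      exact ((Walk.cons_isPath_iff h q).1 hp).2

lemma le_length_of_mem_branch (hG : G.Connected) (p : G.Walk z y) (hz : z ∉ branch G u w)
    (hy : y ∈ branch G u w) : G.dist z u + 1 + G.dist w y ≤ p.length := by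
  induction p with
  | nil => exact absurd hy hz
  | @cons z z' y h p ih =>
    rw [Walk.length_cons]
    by_cases hz' : z' ∈ branch G u w
    · obtain ⟨rfl, rfl⟩ := eq_of_adj_of_notMem_branch h.symm hz' hz
      have := dist_le p
      simp only [dist_self]
      omega
    · have h1 := ih hz' hy
      have h2 := hG.dist_triangle (u := z) (v := z') (w := u)
      rw [dist_eq_one_iff_adj.2 h] at h2
      omega

lemma le_dist_of_mem_branch (hG : G.Connected) (hz : z ∉ branch G u w)
    (hy : y ∈ branch G u w) : G.dist z u + 1 + G.dist w y ≤ G.dist z y := by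
  obtain ⟨p, hp⟩ := hG.exists_walk_length_eq_dist z y
  exact hp ▸ le_length_of_mem_branch hG p hz hy

lemma lt_dist_of_mem_branch (hT : G.IsTree) (huw : G.Adj u w) (hy : y ∈ branch G u w) :
    G.dist w y < G.dist u y := by
  have := le_dist_of_mem_branch hT.connected (notMem_branch hT.isAcyclic huw) hy
  omega

end Branch

/-- If the robber may be at any vertex of `S` and the cops move to `c`, then after his next move
within `X` he may be, uncaptured, at any vertex of `spread G X c S`. -/
def spread {V : Type} (G : SimpleGraph V) (X : Set V) {k : ℕ} (c : Fin k → V) (S : Set V) :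
    Set V :=
  {r' | r' ∈ X ∧ (∀ i, c i ≠ r') ∧ ∃ r ∈ S, (∀ i, c i ≠ r) ∧ (r' = r ∨ G.Adj r r')}

/-- One round of the game against an invisible robber confined to `X`. A state consists of the
positions of the cops and of a set containing every possible position of the robber. -/
def SweepStep {V : Type} (G : SimpleGraph V) (X : Set V) {k : ℕ}
    (s t : (Fin k → V) × Set V) : Prop :=
  (∀ i, t.1 i = s.1 i ∨ G.Adj (s.1 i) (t.1 i)) ∧ spread G X t.1 s.2 ⊆ t.2

/-- Finitely many rounds of the game against an invisible robber confined to `X`. -/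
def Sweep {V : Type} (G : SimpleGraph V) (X : Set V) {k : ℕ} :
    (Fin k → V) × Set V → (Fin k → V) × Set V → Prop :=
  Relation.ReflTransGen (SweepStep G X)

/-- From any positions, `k` cops can capture an invisible robber confined to `X`. -/
def Sweepable {V : Type} (G : SimpleGraph V) (k : ℕ) (X : Set V) : Prop :=
  ∀ c : Fin k → V, ∃ c', Sweep G X (c, X) (c', ∅)

/-- The set `C` contains neither `a` nor `b`, and can only be entered through them. -/
def Separates {V : Type} (G : SimpleGraph V) (a b : V) (C : Set V) : Prop :=
  a ∉ C ∧ b ∉ C ∧ ∀ y z, G.Adj y z → z ∈ C → y ∈ C ∨ y = a ∨ y = b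

section Sweep

variable {V : Type} {G : SimpleGraph V} {X Y C S : Set V} {a b u w : V} {k : ℕ}

lemma Separates.symm (h : Separates G a b C) : Separates G b a C :=
  ⟨h.2.1, h.1, fun y z hyz hz => (h.2.2 y z hyz hz).imp_right Or.symm⟩

lemma Separates.union (hC : Separates G a b C) (hY : Separates G a b Y) :
    Separates G a b (C ∪ Y) := by
  refine ⟨fun h => h.elim hC.1 hY.1, fun h => h.elim hC.2.1 hY.2.1, ?_⟩
  rintro y z hyz (hz | hz)
  · exact (hC.2.2 y z hyz hz).imp_left Or.inl
  · exact (hY.2.2 y z hyz hz).imp_left Or.inr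

lemma separates_branch (hG : G.IsAcyclic) (h : G.Adj u w) : Separates G u u (branch G u w) := by
  refine ⟨notMem_branch hG h, notMem_branch hG h, fun y z hyz hz => ?_⟩
  by_contra! hy
  exact hy.2.1 (eq_of_adj_of_notMem_branch hyz.symm hz hy.1).2

lemma separates_compl_branch : Separates G w w (branch G u w)ᶜ := by
  refine ⟨fun h => h self_mem_branch, fun h => h self_mem_branch, fun y z hyz hz => ?_⟩
  by_contra! hy
  exact hy.2.1 (eq_of_adj_of_notMem_branch hyz (not_not.1 hy.1) hz).1

lemma separates_branch_of_adj (hG : G.IsAcyclic) (huw : G.Adj u w) {x : V} (hwx : G.Adj w x)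
    (hx : x ≠ u) : Separates G u w (branch G w x) := by
  have h := separates_branch hG hwx
  refine ⟨fun hu => ?_, h.1, fun y z hyz hz => (h.2.2 y z hyz hz).imp_right fun h => by tauto⟩
  exact notMem_branch hG huw (branch_subset_branch hG huw hwx hx hu)

lemma Separates.diff_branch (hC : Separates G u u C) :
    Separates G u w (C \ branch G u w) := by
  refine ⟨fun h => hC.1 h.1, fun h => h.2 self_mem_branch, fun y z hyz hz => ?_⟩
  by_cases hy : y ∈ branch G u w
  · exact Or.inr (Or.inr (eq_of_adj_of_notMem_branch hyz hy hz.2).1)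
  · rcases hC.2.2 y z hyz hz.1 with h | h | h
    exacts [Or.inl ⟨h, hy⟩, Or.inr (Or.inl h), Or.inr (Or.inl h)]

lemma Separates.mem_of_move (hC : Separates G a b C) (haS : a ∉ S) {r r' : V} (hr : r ∈ S)
    (hrb : r ≠ b) (hr' : r' ∈ C) (h : r' = r ∨ G.Adj r r') : r ∈ C := by
  rcases h with rfl | h
  · exact hr'
  · rcases hC.2.2 r r' h hr' with h | rfl | h
    exacts [h, absurd hr haS, absurd h hrb]

lemma Separates.disjoint_spread (hC : Separates G a b C) (haS : a ∉ S) (hSC : Disjoint S C)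
    (c : Fin k → V) : Disjoint (spread G X (Fin.cons (α := fun _ => V) b c) S) C := by
  refine Set.disjoint_left.2 ?_
  rintro r' ⟨-, -, r, hr, hrc, hrr'⟩ hr'
  exact Set.disjoint_left.1 hSC hr (hC.mem_of_move haS hr (hrc 0).symm hr' hrr')

lemma sweepStep_cons {t t' : (Fin k → V) × Set V} (hab : b = a ∨ G.Adj a b)
    (h : ∀ i, t'.1 i = t.1 i ∨ G.Adj (t.1 i) (t'.1 i)) :
    SweepStep G X (Fin.cons (α := fun _ => V) a t.1, S) (Fin.cons (α := fun _ => V) b t'.1,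
      spread G X (Fin.cons (α := fun _ => V) b t'.1) S) :=
  ⟨Fin.forall_fin_succ.2 ⟨by simpa using hab, fun i => by simpa using h i⟩, subset_rfl⟩

/-- A cop moving back and forth along the edge `ab` confines the robber to one side of it, so the
remaining cops may play as if the robber were confined to `Y`. -/
lemma Sweep.guard (hab : G.Adj u w) {c : Fin k → V} {R : Set V} {t : (Fin k → V) × Set V}
    (h : Sweep G Y (c, R) t) (hY : Separates G u w Y) (hC : Separates G u w C)
    (hu : s(a, b) = s(u, w)) (haS : a ∉ S) (hSC : Disjoint S C) (hSY : S ∩ Y ⊆ R) :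
    ∃ a' b' S', s(a', b') = s(u, w) ∧
      Sweep G X (Fin.cons (α := fun _ => V) a c, S) (Fin.cons (α := fun _ => V) a' t.1, S') ∧
      a' ∉ S' ∧ Disjoint S' C ∧ S' ∩ Y ⊆ t.2 := by
  induction h with
  | refl => exact ⟨a, b, S, hu, .refl, haS, hSC, hSY⟩
  | @tail t t' _ ht ih =>
    obtain ⟨a, b, S, hab', hs, haS, hSC, hSY⟩ := ih
    have hadj : G.Adj a b := by rwa [← mem_edgeSet, hab']
    have hsep : ∀ {D : Set V}, Separates G u w D → Separates G a b D := by
      intro D hD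
      rcases Sym2.eq_iff.1 hab' with ⟨rfl, rfl⟩ | ⟨rfl, rfl⟩
      exacts [hD, hD.symm]
    refine ⟨b, a, spread G X (Fin.cons (α := fun _ => V) b t'.1) S, by rw [Sym2.eq_swap, hab'],
      hs.tail (sweepStep_cons (Or.inr hadj) ht.1), fun h => h.2.1 0 rfl,
      (hsep hC).disjoint_spread haS hSC _, ?_⟩
    rintro r' ⟨⟨-, hr'c, r, hr, hrc, hrr'⟩, hr'⟩
    exact ht.2 ⟨hr', fun i => hr'c i.succ, r,
      hSY ⟨hr, (hsep hY).mem_of_move haS hr (hrc 0).symm hr' hrr'⟩, fun i => hrc i.succ, hrr'⟩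

/-- With one cop on the edge `uw`, the others clear any set of branches at `w`. -/
lemma exists_sweep_branches_of_guard (hG : G.IsAcyclic) (huw : G.Adj u w)
    (hC : Separates G u w C) (c : Fin k → V) (huS : u ∉ S) (hSC : Disjoint S C) (F : Finset V)
    (hF : ∀ x ∈ F, G.Adj w x ∧ x ≠ u ∧ Sweepable G k (branch G w x)) :
    ∃ a b c' S', s(a, b) = s(u, w) ∧
      Sweep G X (Fin.cons (α := fun _ => V) u c, S) (Fin.cons (α := fun _ => V) a c', S') ∧
      a ∉ S' ∧ Disjoint S' C ∧ ∀ x ∈ F, Disjoint S' (branch G w x) := by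
  classical
  induction F using Finset.induction_on generalizing C with
  | empty => exact ⟨u, w, c, S, rfl, .refl, huS, hSC, by simp⟩
  | insert x F _ ih =>
    obtain ⟨hwx, hxu, hx⟩ := hF x (Finset.mem_insert_self _ _)
    obtain ⟨a, b, c, S, hab, hs, haS, hSC, hSF⟩ :=
      ih hC hSC fun x hx => hF x (Finset.mem_insert_of_mem hx)
    have hD : Separates G u w (C ∪ {y | ∃ x ∈ F, y ∈ branch G w x}) := by
      refine hC.union ⟨?_, ?_, ?_⟩
      · rintro ⟨x, hx, hux⟩
        obtain ⟨h1, h2, -⟩ := hF x (Finset.mem_insert_of_mem hx)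
        exact (separates_branch_of_adj hG huw h1 h2).1 hux
      · rintro ⟨x, hx, hux⟩
        obtain ⟨h1, h2, -⟩ := hF x (Finset.mem_insert_of_mem hx)
        exact (separates_branch_of_adj hG huw h1 h2).2.1 hux
      · rintro y z hyz ⟨x, hx, hux⟩
        obtain ⟨h1, h2, -⟩ := hF x (Finset.mem_insert_of_mem hx)
        exact ((separates_branch_of_adj hG huw h1 h2).2.2 y z hyz hux).imp_left
          fun h => ⟨x, hx, h⟩
    obtain ⟨c', hc'⟩ := hx c
    have hSD : Disjoint S (C ∪ {y | ∃ x ∈ F, y ∈ branch G w x}) := by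
      refine Set.disjoint_union_right.2 ⟨hSC, Set.disjoint_left.2 ?_⟩
      rintro y hy ⟨x, hx, hyx⟩
      exact Set.disjoint_left.1 (hSF x hx) hy hyx
    obtain ⟨a', b', S', hab', hs', haS', hSD', hSx⟩ := hc'.guard (X := X) huw
      (separates_branch_of_adj hG huw hwx hxu) hD hab haS hSD Set.inter_subset_right
    rw [Set.disjoint_union_right] at hSD'
    refine ⟨a', b', c', S', hab', hs.trans hs', haS', hSD'.1, fun z hz => ?_⟩
    rcases Finset.mem_insert.1 hz with rfl | hz
    · exact Set.disjoint_iff.2 hSx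
    · exact Set.disjoint_left.2 fun y hy hyz => Set.disjoint_left.1 hSD'.2 hy ⟨z, hz, hyz⟩

/-- A cop at `u`, assisted by `k` others, clears the branch of a neighbour `w` and returns. -/
lemma exists_sweep_branch [Fintype V] (hT : G.IsTree) (huw : G.Adj u w)
    (hw : ∀ x, G.Adj w x → x ≠ u → Sweepable G k (branch G w x))
    (hC : Separates G u u C) (c : Fin k → V) (huS : u ∉ S) (hSC : Disjoint S C) :
    ∃ c' S', Sweep G X (Fin.cons (α := fun _ => V) u c, S)
        (Fin.cons (α := fun _ => V) u c', S') ∧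
      u ∉ S' ∧ Disjoint S' C ∧ Disjoint S' (branch G u w) := by
  classical
  obtain ⟨a, b, c, S, hab, hs₀, haS, hSC, hSF⟩ := exists_sweep_branches_of_guard (X := X)
    hT.isAcyclic huw hC.diff_branch c huS (hSC.mono_right (Set.sdiff_subset (t := branch G u w)))
    (Finset.univ.filter fun x => G.Adj w x ∧ x ≠ u) (by
      simpa using fun x h1 h2 => ⟨h1, h2, hw x h1 h2⟩)
  obtain ⟨S, hs, hwS, hSC, hSF⟩ : ∃ S', Sweep G X (Fin.cons (α := fun _ => V) a c, S)
      (Fin.cons (α := fun _ => V) w c, S') ∧ w ∉ S' ∧ Disjoint S' (C \ branch G u w) ∧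
      ∀ x, G.Adj w x → x ≠ u → Disjoint S' (branch G w x) := by
    rcases Sym2.eq_iff.1 hab with ⟨rfl, rfl⟩ | ⟨rfl, rfl⟩
    · refine ⟨_, .single (sweepStep_cons (t := (c, S)) (t' := (c, S)) (Or.inr huw)
        fun _ => Or.inl rfl), fun h => h.2.1 0 rfl, hC.diff_branch.disjoint_spread haS hSC _,
        fun x h1 h2 => ?_⟩
      exact (separates_branch_of_adj hT.isAcyclic huw h1 h2).disjoint_spread haS
        (hSF x (by simp [h1, h2])) _
    · exact ⟨S, .refl, haS, hSC, by simpa using hSF⟩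
  have hSB : Disjoint S (branch G u w) := by
    refine Set.disjoint_left.2 fun y hy hyB => ?_
    obtain ⟨x, hwx, hxu, hyx⟩ := exists_mem_branch_of_mem_branch hyB
      (ne_of_mem_of_not_mem hy hwS)
    exact Set.disjoint_left.1 (hSF x hwx hxu) hy hyx
  have hSC : Disjoint S C := by
    refine Set.disjoint_left.2 fun y hy hyC => ?_
    exact Set.disjoint_left.1 hSC hy ⟨hyC, Set.disjoint_left.1 hSB hy⟩
  have hD : ∀ {D : Set V}, Separates G u u D → Disjoint S D →
      Disjoint (spread G X (Fin.cons (α := fun _ => V) u c) S) D := by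
    intro D hD hSD
    refine Set.disjoint_left.2 ?_
    rintro r' ⟨-, -, r, hr, hrc, rfl | hrr'⟩ hr'
    · exact Set.disjoint_left.1 hSD hr hr'
    · rcases hD.2.2 r r' hrr' hr' with h | h | h
      exacts [Set.disjoint_left.1 hSD hr h, hrc 0 h.symm, hrc 0 h.symm]
  exact ⟨c, _, (hs₀.trans hs).tail (sweepStep_cons (t := (c, S)) (t' := (c, S)) (Or.inr huw.symm)
    fun _ => Or.inl rfl), fun h => h.2.1 0 rfl, hD hC hSC,
    hD (separates_branch hT.isAcyclic huw) hSB⟩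

/-- A cop at `u`, assisted by `k` others, clears the branches of any set of neighbours of `u`. -/
lemma exists_sweep_branches [Fintype V] (hT : G.IsTree) (hC : Separates G u u C) (c : Fin k → V)
    (huS : u ∉ S) (hSC : Disjoint S C) (F : Finset V)
    (hF : ∀ w ∈ F, G.Adj u w ∧ ∀ x, G.Adj w x → x ≠ u → Sweepable G k (branch G w x)) :
    ∃ c' S', Sweep G X (Fin.cons (α := fun _ => V) u c, S)
        (Fin.cons (α := fun _ => V) u c', S') ∧
      u ∉ S' ∧ Disjoint S' C ∧ ∀ w ∈ F, Disjoint S' (branch G u w) := by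
  classical
  induction F using Finset.induction_on generalizing C S c with
  | empty => exact ⟨c, S, .refl, huS, hSC, by simp⟩
  | insert w F _ ih =>
    obtain ⟨huw, hw⟩ := hF w (Finset.mem_insert_self _ _)
    obtain ⟨c, S, hs, huS, hSC, hSw⟩ := exists_sweep_branch (X := X) hT huw hw hC c huS hSC
    obtain ⟨c', S', hs', huS', hSC', hSF⟩ := ih (hC.union (separates_branch hT.isAcyclic huw)) c
      huS (Set.disjoint_union_right.2 ⟨hSC, hSw⟩) fun x hx => hF x (Finset.mem_insert_of_mem hx)
    rw [Set.disjoint_union_right] at hSC'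
    refine ⟨c', S', hs.trans hs', huS', hSC'.1, fun z hz => ?_⟩
    rcases Finset.mem_insert.1 hz with rfl | hz
    exacts [hSC'.2, hSF z hz]

lemma eq_empty_of_disjoint_branch (hwS : w ∉ S) (hS : Disjoint S (branch G u w)ᶜ)
    (h : ∀ x, G.Adj w x → x ≠ u → Disjoint S (branch G w x)) : S = ∅ := by
  refine Set.eq_empty_iff_forall_notMem.2 fun y hy => ?_
  obtain ⟨x, hwx, hxu, hyx⟩ := exists_mem_branch_of_mem_branch
    (Set.disjoint_compl_right_iff_subset.1 hS hy) (ne_of_mem_of_not_mem hy hwS)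
  exact Set.disjoint_left.1 (h x hwx hxu) hy hyx

/-- One cop can travel to any vertex. -/
lemma exists_sweep_travel (c : Fin k → V) (p : G.Walk a b) (S : Set V) :
    ∃ S', Sweep G X (Fin.cons (α := fun _ => V) a c, S)
      (Fin.cons (α := fun _ => V) b c, S') ∧ S' ⊆ X ∧ b ∉ S' := by
  induction p generalizing S with
  | nil => exact ⟨_, .single (sweepStep_cons (t := (c, S)) (t' := (c, S)) (Or.inl rfl)
      fun _ => Or.inl rfl), fun _ h => h.1, fun h => h.2.1 0 rfl⟩
  | cons h p ih =>
    obtain ⟨S', hS', h1⟩ := ih (spread G X (Fin.cons (α := fun _ => V) _ c) S)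
    exact ⟨S', .head (sweepStep_cons (t := (c, S)) (t' := (c, S)) (Or.inr h)
      fun _ => Or.inl rfl) hS', h1⟩

lemma sweepable_branch [Fintype V] (hT : G.IsTree) (huw : G.Adj u w)
    (h : ∀ y ∈ branch G u w, G.dist w y < 2 * k) : Sweepable G k (branch G u w) := by
  classical
  induction k generalizing u w with
  | zero => exact absurd (h w self_mem_branch) (by simp)
  | succ k ih =>
    intro c
    obtain ⟨p⟩ := hT.connected (c 0) w
    obtain ⟨S, hs, hSX, hwS⟩ :=
      exists_sweep_travel (X := branch G u w) (Fin.tail c) p (branch G u w)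
    obtain ⟨c', S', hs', hwS', hSC, hSF⟩ := exists_sweep_branches (X := branch G u w) (k := k) hT
      separates_compl_branch (Fin.tail c) hwS
      (Set.disjoint_compl_right_iff_subset.2 hSX)
      (Finset.univ.filter fun x => G.Adj w x ∧ x ≠ u) (by
        simp only [Finset.mem_filter, Finset.mem_univ, true_and]
        rintro x ⟨hwx, hxu⟩
        refine ⟨hwx, fun z hxz hzw => ih hxz fun y hy => ?_⟩
        have hyx := branch_subset_branch hT.isAcyclic hwx hxz hzw hy
        have := h y (branch_subset_branch hT.isAcyclic huw hwx hxu hyx)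
        have := lt_dist_of_mem_branch hT hxz hy
        have := lt_dist_of_mem_branch hT hwx hyx
        omega)
    have hS' : S' = ∅ := eq_empty_of_disjoint_branch hwS' hSC fun x h1 h2 =>
      hSF x (by simp [h1, h2])
    rw [Fin.cons_self_tail] at hs
    exact ⟨_, hS' ▸ hs.trans hs'⟩

lemma sweepable_branch_of_dist [Fintype V] (hT : G.IsTree) {v x : V} (huw : G.Adj u w)
    (hwx : G.Adj w x) (hxu : x ≠ u) (hvu : G.Adj v u) (hwv : w ≠ v)
    (h : ∀ y ∈ branch G v u, G.dist u y ≤ 2 * k + 1) : Sweepable G k (branch G w x) := by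
  refine sweepable_branch hT hwx fun y hy => ?_
  have hyw := branch_subset_branch hT.isAcyclic huw hwx hxu hy
  have := h y (branch_subset_branch hT.isAcyclic hvu huw hwv hyw)
  have := lt_dist_of_mem_branch hT hwx hy
  have := lt_dist_of_mem_branch hT huw hyw
  omega

/-- An edge all of whose sides are shallow yields a sweep of the whole tree. -/
lemma exists_sweep_of_edge [Fintype V] (hT : G.IsTree) {v : V} (huv : G.Adj u v)
    (hu : ∀ y ∈ branch G v u, G.dist u y ≤ 2 * k + 1)
    (hv : ∀ y ∈ branch G u v, G.dist v y ≤ 2 * k + 1) :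
    ∃ c c' : Fin (k + 1) → V, Sweep G Set.univ (c, Set.univ) (c', ∅) := by
  classical
  obtain ⟨S, hs, -, huS⟩ := exists_sweep_travel (X := Set.univ) (fun _ : Fin k => u)
    (Walk.nil : G.Walk u u) Set.univ
  obtain ⟨c, S, hs', huS, -, hSF⟩ := exists_sweep_branches (X := Set.univ) (k := k) hT
    (C := ∅) (by simp [Separates]) (fun _ : Fin k => u) huS (by simp)
    (Finset.univ.filter fun x => G.Adj u x ∧ x ≠ v) (by
      simp only [Finset.mem_filter, Finset.mem_univ, true_and]
      rintro w ⟨huw, hwv⟩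
      exact ⟨huw, fun x hwx hxu => sweepable_branch_of_dist hT huw hwx hxu huv.symm hwv hu⟩)
  have hSB : S ⊆ branch G u v := by
    intro y hy
    obtain ⟨w, huw, hyw⟩ := exists_mem_branch hT.connected (ne_of_mem_of_not_mem hy huS)
    by_cases hwv : w = v
    · exact hwv ▸ hyw
    · exact absurd hyw (Set.disjoint_left.1 (hSF w (by simp [huw, hwv])) hy)
  have hSC : Disjoint (spread G Set.univ (Fin.cons (α := fun _ => V) v c) S)
      (branch G u v)ᶜ := by
    refine Set.disjoint_left.2 ?_
    rintro r' ⟨-, -, r, hr, hrc, rfl | hrr'⟩ hr'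
    · exact hr' (hSB hr)
    · exact hrc 0 (eq_of_adj_of_notMem_branch hrr' (hSB hr) hr').1.symm
  obtain ⟨c', S', hs'', hvS', hSC', hSF'⟩ := exists_sweep_branches (X := Set.univ) (k := k) hT
    separates_compl_branch c (fun h => h.2.1 0 rfl) hSC
    (Finset.univ.filter fun x => G.Adj v x ∧ x ≠ u) (by
      simp only [Finset.mem_filter, Finset.mem_univ, true_and]
      rintro w ⟨hvw, hwu⟩
      exact ⟨hvw, fun x hwx hxv => sweepable_branch_of_dist hT hvw hwx hxv huv hwu hv⟩)
  have hS' : S' = ∅ := eq_empty_of_disjoint_branch hvS' hSC' fun x h1 h2 =>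
      hSF' x (by simp [h1, h2])
  exact ⟨_, _, hS' ▸ ((hs.trans hs').tail (sweepStep_cons (t := (c, S)) (t' := (c, S))
    (Or.inr huv) fun _ => Or.inl rfl)).trans hs''⟩

lemma exists_sweep_of_vertex [Fintype V] (hT : G.IsTree) (hu : ∀ y, G.dist u y ≤ 2 * k + 1) :
    ∃ c c' : Fin (k + 1) → V, Sweep G Set.univ (c, Set.univ) (c', ∅) := by
  classical
  obtain ⟨S, hs, -, huS⟩ := exists_sweep_travel (X := Set.univ) (fun _ : Fin k => u)
    (Walk.nil : G.Walk u u) Set.univ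
  obtain ⟨c, S', hs', huS', -, hSF⟩ := exists_sweep_branches (X := Set.univ) (k := k) hT
    (C := ∅) (by simp [Separates]) (fun _ : Fin k => u) huS (by simp)
    (Finset.univ.filter fun x => G.Adj u x) (by
      simp only [Finset.mem_filter, Finset.mem_univ, true_and]
      refine fun w huw => ⟨huw, fun x hwx hxu => sweepable_branch hT hwx fun y hy => ?_⟩
      have := lt_dist_of_mem_branch hT hwx hy
      have := lt_dist_of_mem_branch hT huw
        (branch_subset_branch hT.isAcyclic huw hwx hxu hy)
      have := hu y
      omega)
  have hS' : S' = ∅ := by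
    refine Set.eq_empty_iff_forall_notMem.2 fun y hy => ?_
    obtain ⟨w, huw, hyw⟩ := exists_mem_branch hT.connected (ne_of_mem_of_not_mem hy huS')
    exact Set.disjoint_left.1 (hSF w (by simp [huw])) hy hyw
  exact ⟨_, _, hS' ▸ hs.trans hs'⟩

lemma dist_le_of_mem_branch [Finite V] (hT : G.IsTree) {v : V} (huv : G.Adj u v)
    (hb : G.dist v b < G.dist u b) {m : ℕ} (hm : G.diam ≤ G.dist v b + m + 1) :
    ∀ y ∈ branch G v u, G.dist u y ≤ m := by
  intro y hy
  have hbB : b ∉ branch G v u := fun h => (lt_dist_of_mem_branch hT huv.symm h).not_gt hb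
  have h1 := le_dist_of_mem_branch hT.connected hbB hy
  have := hT.connected.nonempty
  have h2 : G.dist b y ≤ G.diam := dist_le_diam (connected_iff_ediam_ne_top.1 hT.connected)
  rw [G.dist_comm (u := b)] at h1
  omega

lemma exists_sweep_of_diam_le [Fintype V] (hT : G.IsTree) (h : G.diam ≤ 4 * k + 3) :
    ∃ c c' : Fin (k + 1) → V, Sweep G Set.univ (c, Set.univ) (c', ∅) := by
  have := hT.connected.nonempty
  obtain ⟨a, b, hab⟩ := G.exists_dist_eq_diam
  have hdiam : ∀ y z, G.dist y z ≤ G.diam := fun y z =>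
    dist_le_diam (connected_iff_ediam_ne_top.1 hT.connected)
  rcases le_or_gt G.diam (2 * k + 1) with hD | hD
  · exact exists_sweep_of_vertex (u := a) hT fun y => (hdiam a y).trans hD
  obtain ⟨p, hp⟩ := hT.connected.exists_walk_length_eq_dist a b
  have hadj : G.Adj (p.getVert (2 * k + 1)) (p.getVert (2 * k + 1 + 1)) :=
    p.adj_getVert_succ (by omega)
  have h1 := dist_le (p.take (2 * k + 1))
  have h2 := dist_le (p.drop (2 * k + 1 + 1))
  rw [Walk.take_length] at h1
  rw [Walk.drop_length] at h2
  generalize p.getVert (2 * k + 1) = u at *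
  generalize p.getVert (2 * k + 1 + 1) = v at *
  have h3 := hT.connected.dist_triangle (u := a) (v := u) (w := b)
  have h4 := hT.connected.dist_triangle (u := a) (v := v) (w := b)
  have h5 := hT.connected.dist_triangle (u := u) (v := v) (w := b)
  rw [dist_eq_one_iff_adj.2 hadj] at h5
  have h6 := G.dist_comm (u := a) (v := u)
  have h7 := G.dist_comm (u := a) (v := v)
  exact exists_sweep_of_edge hT hadj (dist_le_of_mem_branch (b := b) hT hadj (by omega) (by omega))
    (dist_le_of_mem_branch (b := a) hT hadj.symm (by omega) (by omega))

/-- A sweep gives a sequence of positions meeting every walk of the robber. -/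
lemma Sweep.exists_seq {c c' : Fin k → V} (h : Sweep G Set.univ (c, S) (c', ∅)) :
    ∃ P : ℕ → Fin k → V, (∀ n i, P (n + 1) i = P n i ∨ G.Adj (P n i) (P (n + 1) i)) ∧ P 0 = c ∧
      ∀ r : ℕ → V, (∀ n, r (n + 1) = r n ∨ G.Adj (r n) (r (n + 1))) → r 0 ∈ S →
        ∃ n i, P n i = r n ∨ P (n + 1) i = r n := by
  suffices H : ∀ s : (Fin k → V) × Set V, Sweep G Set.univ s (c', ∅) →
      ∃ P : ℕ → Fin k → V, (∀ n i, P (n + 1) i = P n i ∨ G.Adj (P n i) (P (n + 1) i)) ∧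
      P 0 = s.1 ∧ ∀ r : ℕ → V, (∀ n, r (n + 1) = r n ∨ G.Adj (r n) (r (n + 1))) → r 0 ∈ s.2 →
        ∃ n i, P n i = r n ∨ P (n + 1) i = r n from H _ h
  intro s hs
  induction hs using Relation.ReflTransGen.head_induction_on with
  | refl => exact ⟨fun _ => c', fun _ _ => Or.inl rfl, rfl, fun r _ h => h.elim⟩
  | @head s t hst _ ih =>
    obtain ⟨P, hP, hP0, hcap⟩ := ih
    refine ⟨fun n => Nat.casesOn n s.1 P, ?_, rfl, fun r hr hr0 => ?_⟩
    · rintro (_ | n) i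
      · simpa [hP0] using hst.1 i
      · exact hP n i
    by_contra! hno
    have h0 : ∀ i, t.1 i ≠ r 0 := fun i => hP0 ▸ (hno 0 i).2
    have h1 : ∀ i, t.1 i ≠ r 1 := fun i => hP0 ▸ (hno 1 i).1
    obtain ⟨n, i, hn⟩ := hcap (fun n => r (n + 1)) (fun n => hr (n + 1))
      (hst.2 ⟨Set.mem_univ _, h1, r 0, hr0, h0, hr 0⟩)
    exact hn.elim (hno (n + 1) i).1 (hno (n + 1) i).2

end Sweep

open Classical in
/-- The strategy following a fixed sequence of positions, whatever is observed. -/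
noncomputable def seqStrategy {V : Type} (G : SimpleGraph V) {d : ℕ} (P : ℕ → Fin d → V) :
    CopStrategy V d where
  init := P 0
  move h p i := if P h.length i = p i ∨ G.Adj (p i) (P h.length i) then P h.length i else p i

lemma play_seqStrategy {V : Type} {G : SimpleGraph V} {d : ℕ} {P : ℕ → Fin d → V}
    (hP : ∀ n i, P (n + 1) i = P n i ∨ G.Adj (P n i) (P (n + 1) i))
    (vis : (Fin d → V) → V → Prop) (R : RobberStrategy V d) (n : ℕ) :
    (play vis (seqStrategy G P) R n).1.1 = P n ∧
      (play vis (seqStrategy G P) R n).2.1.length = n := by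
  induction n with
  | zero => exact ⟨rfl, rfl⟩
  | succ n ih =>
    refine ⟨?_, by simp [play, ih.2]⟩
    funext i
    have key : ∀ l : List (Option V), l.length = n + 1 →
        (seqStrategy G P).move l (P n) i = P (n + 1) i := fun l hl => by
      simp [seqStrategy, hl, hP n i]
    change (seqStrategy G P).move (_ :: (play vis (seqStrategy G P) R n).2.1)
      (play vis (seqStrategy G P) R n).1.1 i = _
    rw [ih.1]
    exact key _ (by simp [ih.2])

lemma winningCopStrategy_seqStrategy {V : Type} {G : SimpleGraph V} {d : ℕ} {P : ℕ → Fin d → V}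
    (hP : ∀ n i, P (n + 1) i = P n i ∨ G.Adj (P n i) (P (n + 1) i))
    (hcap : ∀ r : ℕ → V, (∀ n, r (n + 1) = r n ∨ G.Adj (r n) (r (n + 1))) →
      ∃ n i, P n i = r n ∨ P (n + 1) i = r n) (vis : (Fin d → V) → V → Prop) :
    WinningCopStrategy G vis (seqStrategy G P) := by
  classical
  refine ⟨fun h p i => ?_, fun R hR => ?_⟩
  · by_cases hi : P h.length i = p i ∨ G.Adj (p i) (P h.length i)
    · simp [seqStrategy, hi]
    · simp [seqStrategy, hi]
  · obtain ⟨n, i, h⟩ := hcap (robPos vis (seqStrategy G P) R) fun n => hR _ _ _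
    refine ⟨n, i, ?_⟩
    rwa [copPos, copPos, (play_seqStrategy hP vis R n).1, (play_seqStrategy hP vis R (n + 1)).1]

/-- If `T` is a finite tree, then `c₀(T) ≤ ⌊diam(T)/4⌋ + 1`. -/
theorem stmt15 {V : Type} [Fintype V] (T : SimpleGraph V) (hT : T.IsTree) :
    zeroVisCopNumber T ≤ T.diam / 4 + 1 := by
  obtain ⟨c, c', h⟩ := exists_sweep_of_diam_le (k := T.diam / 4) hT (by omega)
  obtain ⟨P, hP, -, hcap⟩ := h.exists_seq
  exact Nat.sInf_le ⟨_,
    winningCopStrategy_seqStrategy hP (fun r hr => hcap r hr (Set.mem_univ _)) _⟩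

end CopsRobber
end

section
/- Let k ≥ 1 be an integer and let T be a finite tree with diam(T) ≥ 2k−1. Then c_{H,k}(T) ≤ 2. -/
namespace CopsRobber

open SimpleGraph

section TreeDistance

variable {V : Type} {T : SimpleGraph V}

/-- In a tree, a vertex has at most one neighbour closer to a given vertex. -/
theorem neighbor_closer_unique (hT : T.IsTree) {q r x y : V} (hx : T.Adj r x) (hy : T.Adj r y)
    (dx : T.dist x q + 1 = T.dist r q) (dy : T.dist y q + 1 = T.dist r q) : x = y := by
  obtain ⟨p, hp⟩ := hT.connected.exists_walk_length_eq_dist x q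
  obtain ⟨p', hp'⟩ := hT.connected.exists_walk_length_eq_dist y q
  have h : (Walk.cons hx p).IsPath := Walk.isPath_of_length_eq_dist _ (by simp [hp, dx])
  have h' : (Walk.cons hy p').IsPath := Walk.isPath_of_length_eq_dist _ (by simp [hp', dy])
  have := congrArg Walk.snd ((hT.existsUnique_path r q).unique h h')
  simpa using this

theorem exists_neighbor_closer (hT : T.Connected) {x y : V} (hne : x ≠ y) :
    ∃ z, T.Adj x z ∧ T.dist z y + 1 = T.dist x y := by
  obtain ⟨p, hp⟩ := hT.exists_walk_length_eq_dist x y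
  cases p with
  | nil => exact absurd rfl hne
  | @cons _ z _ h p =>
    refine ⟨z, h, ?_⟩
    have h1 := dist_le p
    have h2 := hT.dist_triangle (u := x) (v := z) (w := y)
    rw [dist_eq_one_iff_adj.2 h] at h2
    rw [Walk.length_cons] at hp
    omega

/-- The vertex `p` lies on a shortest path between `q` and `r`. -/
def Between (T : SimpleGraph V) (q p r : V) : Prop :=
  T.dist q r = T.dist q p + T.dist p r

theorem Between.symm {q p r : V} (h : Between T q p r) : Between T r p q := by
  unfold Between at *
  rw [T.dist_comm, h, T.dist_comm (u := q), T.dist_comm (u := p) (v := r), add_comm]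

/-- Walking from `r ≠ p` to a neighbour does not leave the part of the tree cut off by `p`. -/
theorem Between.of_adj (hT : T.IsTree) {q p r s : V} (h : Between T q p r) (hne : r ≠ p)
    (ha : T.Adj r s) : Between T q p s := by
  unfold Between at *
  have hp := hT.dist_eq_dist_add_one_of_adj p ha
  have hq := hT.dist_eq_dist_add_one_of_adj q ha
  have htri := hT.connected.dist_triangle (u := q) (v := p) (w := s)
  by_contra hcon
  have hp' : T.dist p s = T.dist p r + 1 := by omega
  have hq' : T.dist q r = T.dist q s + 1 := by omega
  obtain ⟨z, hz, hzd⟩ := exists_neighbor_closer hT.connected hne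
  have hzq := hT.connected.dist_triangle (u := q) (v := p) (w := z)
  have hzq' := hT.dist_eq_dist_add_one_of_adj q hz
  have : z = s := by
    rw [T.dist_comm (v := p), T.dist_comm (v := p)] at hzd
    refine neighbor_closer_unique hT (q := q) hz ha ?_ ?_ <;>
      rw [T.dist_comm (v := q), T.dist_comm (v := q)] <;> omega
  subst this
  rw [T.dist_comm (v := p), T.dist_comm (v := p)] at hzd
  omega

theorem Between.of_eq_or_adj (hT : T.IsTree) {q p r s : V} (h : Between T q p r) (hne : r ≠ p)
    (ha : s = r ∨ T.Adj r s) : Between T q p s := by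
  obtain rfl | ha := ha
  · exact h
  · exact h.of_adj hT hne ha

theorem Between.trans_of_ne (hT : T.IsTree) {b v u r : V} (hb : Between T b v u)
    (hr : Between T v u r) (hne : u ≠ v) : Between T b u r := by
  induction hn : T.dist b v generalizing b with
  | zero => rwa [hT.connected.dist_eq_zero_iff.1 hn]
  | succ n ih =>
    have hbv : b ≠ v := by
      rintro rfl
      simp at hn
    obtain ⟨c, hc, hcd⟩ := exists_neighbor_closer hT.connected hbv
    have hpos := hT.connected.pos_dist_of_ne hne
    have h1 := hT.connected.dist_triangle (u := b) (v := c) (w := u)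
    have h2 := hT.connected.dist_triangle (u := c) (v := v) (w := u)
    rw [dist_eq_one_iff_adj.2 hc] at h1
    have hcu : Between T c v u := by
      unfold Between at *
      omega
    have hcne : c ≠ u := by
      rintro rfl
      unfold Between at *
      rw [dist_comm (u := v)] at *
      simp at hcu
      omega
    exact ((ih hcu (by omega)).symm.of_adj hT hcne hc.symm).symm

/-- In a tree, the ends of an edge are at different distances from any vertex. -/
theorem between_or_between_of_adj (hT : T.IsTree) {u v : V} (h : T.Adj u v) (r : V) :
    Between T v u r ∨ Between T u v r := by
  have := hT.dist_eq_dist_add_one_of_adj r h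
  unfold Between
  rw [dist_eq_one_iff_adj.2 h, dist_eq_one_iff_adj.2 h.symm, dist_comm (u := u) (v := r),
    dist_comm (u := v) (v := r)]
  omega

theorem not_between_of_between_of_adj {u v r : V} (h : T.Adj u v)
    (hr : Between T u v r) : ¬ Between T v u r := by
  unfold Between at *
  rw [dist_eq_one_iff_adj.2 h] at hr
  rw [dist_eq_one_iff_adj.2 h.symm]
  omega

/-- A longest path of a tree of diameter at least `2k - 1` contains an edge `uv` whose
ends are each at distance at least `k` from the end of the path on the other side. -/
theorem exists_edge_on_longest_path (hT : T.IsTree) {k : ℕ} (hk : 1 ≤ k)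
    (hdiam : 2 * k - 1 ≤ T.diam) :
    ∃ a u v b : V, T.Adj u v ∧ k ≤ T.dist a v ∧ k ≤ T.dist b u ∧
      Between T a u v ∧ Between T b v u := by
  have := hT.connected.nonempty
  obtain ⟨a, b, hab⟩ := T.exists_dist_eq_diam
  obtain ⟨p, hp⟩ := hT.connected.exists_walk_length_eq_dist a b
  have hadj : T.Adj (p.getVert (k - 1)) (p.getVert k) := by
    have := p.adj_getVert_succ (i := k - 1) (by omega)
    rwa [Nat.sub_add_cancel hk] at this
  refine ⟨a, p.getVert (k - 1), p.getVert k, b, hadj, ?_⟩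
  have h1 := dist_le (p.take (k - 1))
  have h2 := dist_le (p.drop k)
  rw [Walk.take_length] at h1
  rw [Walk.drop_length] at h2
  generalize p.getVert (k - 1) = u at *
  generalize p.getVert k = v at *
  have h3 := dist_eq_one_iff_adj.2 hadj
  have h4 := hT.connected.dist_triangle (u := a) (v := u) (w := b)
  have h5 := hT.connected.dist_triangle (u := u) (v := v) (w := b)
  have h6 := hT.connected.dist_triangle (u := a) (v := v) (w := b)
  have h7 := hT.connected.dist_triangle (u := a) (v := u) (w := v)
  unfold Between
  rw [dist_comm (u := b) (v := u), dist_comm (u := b) (v := v),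
    dist_comm (u := v) (v := u)]
  omega

open Classical in
/-- A neighbour of `x` closer to `y`, or `x` itself if `x = y`. -/
noncomputable def stepToward (T : SimpleGraph V) (x y : V) : V :=
  if h : ∃ z, T.Adj x z ∧ T.dist z y + 1 = T.dist x y then h.choose else x

theorem stepToward_eq_or_adj (x y : V) :
    stepToward T x y = x ∨ T.Adj x (stepToward T x y) := by
  unfold stepToward
  split_ifs with h
  · exact Or.inr h.choose_spec.1
  · exact Or.inl rfl

theorem dist_stepToward (hT : T.Connected) (x y : V) :
    T.dist (stepToward T x y) y = T.dist x y - 1 := by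
  by_cases hxy : x = y
  · subst hxy
    simp [stepToward]
  · have h := exists_neighbor_closer hT hxy
    have := h.choose_spec.2
    rw [stepToward, dif_pos h]
    omega

/-- A pursuer `x` separating the robber `r` from a fixed vertex `q` at distance at least `k`, and
stepping toward the robber whenever he is at distance more than `k` from `q`, reaches him. -/
theorem pursuit_captures [Finite V] (hT : T.IsTree) {k : ℕ} {q : V} {x r : ℕ → V}
    (hr : ∀ n, r (n + 1) = r n ∨ T.Adj (r n) (r (n + 1)))
    (hx : ∀ n, k < T.dist q (r n) → x (n + 1) = stepToward T (x n) (r n))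
    (hbtw : Between T q (x 0) (r 0)) (hk : k ≤ T.dist q (x 0)) :
    ∃ n, x n = r n ∨ x (n + 1) = r n := by
  by_contra! hcon
  have key : ∀ n, Between T q (x n) (r n) ∧ k + n ≤ T.dist q (x n) := by
    intro n
    induction n with
    | zero => exact ⟨hbtw, hk⟩
    | succ n ih =>
      obtain ⟨hb, hd⟩ := ih
      have hpos := hT.connected.pos_dist_of_ne (hcon n).1
      have hstep := hx n (by unfold Between at hb; omega)
      have h1 := dist_stepToward hT.connected (x n) (r n)
      rw [← hstep] at h1
      have h2 := hT.connected.dist_triangle (u := q) (v := x (n + 1)) (w := r n)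
      have h3 := hT.connected.dist_triangle (u := q) (v := x n) (w := x (n + 1))
      have h4 : T.dist (x n) (x (n + 1)) ≤ 1 := by
        rw [hstep]
        obtain h | h := stepToward_eq_or_adj (T := T) (x n) (r n)
        · simp [h]
        · exact (dist_eq_one_iff_adj.2 h).le
      have hb' : Between T q (x (n + 1)) (r n) := by
        unfold Between at *
        omega
      refine ⟨hb'.of_eq_or_adj hT (hcon n).2.symm (hr n), ?_⟩
      unfold Between at *
      omega
  have := hT.connected.nonempty
  have hle := dist_le_diam (connected_iff_ediam_ne_top.1 hT.connected) (u := q)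
    (v := x (T.diam + 1))
  have := (key (T.diam + 1)).2
  omega

end TreeDistance

section Play

variable {V : Type} {d : ℕ} {vis : (Fin d → V) → V → Prop} {S : CopStrategy V d}
  {R : RobberStrategy V d}

/-- The observation made by the cops at the start of round `n`. -/
noncomputable def observation (vis : (Fin d → V) → V → Prop) (S : CopStrategy V d)
    (R : RobberStrategy V d) (n : ℕ) : Option V :=
  observe vis (copPos vis S R n) (robPos vis S R n)

/-- The list of observations available to the cops in round `n`. -/
noncomputable def observationLog (vis : (Fin d → V) → V → Prop) (S : CopStrategy V d)
    (R : RobberStrategy V d) (n : ℕ) : List (Option V) :=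
  observation vis S R n :: (play vis S R n).2.1

theorem observationLog_succ (n : ℕ) : observationLog vis S R (n + 1) =
    observation vis S R (n + 1) :: observationLog vis S R n := rfl

theorem copPos_succ (n : ℕ) :
    copPos vis S R (n + 1) = S.move (observationLog vis S R n) (copPos vis S R n) := rfl

theorem robPos_succ_eq_or_adj {G : SimpleGraph V} (hR : R.Legal G) (n : ℕ) :
    robPos vis S R (n + 1) = robPos vis S R n ∨
      G.Adj (robPos vis S R n) (robPos vis S R (n + 1)) :=
  hR _ _ _

theorem length_observationLog (n : ℕ) : (observationLog vis S R n).length = n + 1 := by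
  induction n with
  | zero => rfl
  | succ n ih => rw [observationLog_succ, List.length_cons, ih]

theorem getLast?_observationLog (n : ℕ) :
    (observationLog vis S R n).getLast? = some (observation vis S R 0) := by
  induction n with
  | zero => rfl
  | succ n ih =>
    rw [observationLog_succ, List.getLast?_cons, ih]
    rfl

theorem observation_eq_some {n : ℕ} (h : vis (copPos vis S R n) (robPos vis S R n)) :
    observation vis S R n = some (robPos vis S R n) := if_pos h

theorem eq_robPos_of_observation_eq_some {n : ℕ} {r : V} (h : observation vis S R n = some r) :
    r = robPos vis S R n := by
  unfold observation observe at h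
  split_ifs at h
  exact (Option.some.inj h).symm

end Play

/-- Step toward the robber if he is currently visible, and stay put otherwise. -/
noncomputable def pursue {V : Type} (T : SimpleGraph V) (h : List (Option V)) (x : V) : V :=
  match h with
  | some r :: _ => stepToward T x r
  | _ => x

theorem pursue_eq_or_adj {V : Type} {T : SimpleGraph V} (h : List (Option V)) (x : V) :
    pursue T h x = x ∨ T.Adj x (pursue T h x) := by
  unfold pursue
  split
  · exact stepToward_eq_or_adj _ _
  · exact Or.inl rfl

open Classical in
/-- The strategy of two cops starting at `u` and `b`. If the robber is first seen on the side of
`u` of the edge `uv`, the first cop pursues him. Otherwise the second cop walks to `v`, then the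
first cop walks to `a`, and then the second cop pursues the robber. Each walk is given `m`
rounds. -/
noncomputable def edgeStrategy {V : Type} (T : SimpleGraph V) (m : ℕ) (a u v b : V) :
    CopStrategy V 2 where
  init := ![u, b]
  move h p :=
    if ∃ r, h.getLast? = some (some r) ∧ Between T v u r then ![pursue T h (p 0), p 1]
    else if h.length ≤ m then ![p 0, stepToward T (p 1) v]
    else if h.length ≤ 2 * m then ![stepToward T (p 0) a, p 1]
    else ![p 0, pursue T h (p 1)]

theorem edgeStrategy_legal {V : Type} (T : SimpleGraph V) (m : ℕ) (a u v b : V) :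
    (edgeStrategy T m a u v b).Legal T := by
  intro h p i
  unfold edgeStrategy
  dsimp only
  split_ifs <;> fin_cases i <;>
    simp [stepToward_eq_or_adj, pursue_eq_or_adj]

theorem edgeStrategy_captures {V : Type} [Finite V] {T : SimpleGraph V} (hT : T.IsTree) {k m : ℕ}
    {a u v b : V} (huv : T.Adj u v) (hua : T.dist u a ≤ m) (hbv : T.dist b v ≤ m)
    (hav : k ≤ T.dist a v) (hbu : k ≤ T.dist b u) (hauv : Between T a u v)
    (hbvu : Between T b v u) {vis : (Fin 2 → V) → V → Prop}
    (hvis : ∀ c r i, k < T.dist (c i) r → vis c r) {R : RobberStrategy V 2} (hR : R.Legal T) :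
    Captures vis (edgeStrategy T m a u v b) R := by
  set S := edgeStrategy T m a u v b
  by_contra hcap
  simp only [Captures, not_exists, not_or] at hcap
  have hrob := robPos_succ_eq_or_adj (vis := vis) (S := S) hR
  set r := robPos vis S R
  have hc0 : copPos vis S R 0 = ![u, b] := rfl
  have hmove : ∀ n, copPos vis S R (n + 1) = _ := fun n =>
    copPos_succ (vis := vis) (S := S) (R := R) n
  set c := copPos vis S R
  have hpursue : ∀ n i x, k < T.dist (c n i) (r n) →
      pursue T (observationLog vis S R n) x = stepToward T x (r n) := by
    intro n i x hd
    have := observation_eq_some (S := S) (R := R) (n := n) (hvis _ _ i hd)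
    rw [observationLog, this]
    rfl
  by_cases hleft : Between T v u (r 0)
  · have hb0 := hbvu.trans_of_ne hT hleft huv.ne
    have hne : r 0 ≠ u := fun h => (hcap 0 0).1 (by rw [hc0]; exact h.symm)
    have hobs : observation vis S R 0 = some (r 0) := by
      refine observation_eq_some (hvis _ _ 1 ?_)
      have := hT.connected.pos_dist_of_ne hne.symm
      change k < T.dist b (r 0)
      unfold Between at hb0
      omega
    have hmv : ∀ n, c (n + 1) = ![pursue T (observationLog vis S R n) (c n 0), c n 1] := by
      intro n
      rw [hmove n]
      exact if_pos ⟨r 0, by rw [getLast?_observationLog, hobs], hleft⟩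
    have hc1 : ∀ n, c n 1 = b := by
      intro n
      induction n with
      | zero => rfl
      | succ n ih => rw [hmv n]; exact ih
    obtain ⟨n, hn⟩ := pursuit_captures hT (k := k) (q := b) (x := fun n => c n 0) (r := r) hrob
      (fun n hd => by
        simp only [hmv n]
        exact hpursue n 1 _ (by rwa [hc1 n])) hb0 hbu
    exact hn.elim (hcap n 0).1 (hcap n 0).2
  · have hmv : ∀ n, c (n + 1) =
        if n + 1 ≤ m then ![c n 0, stepToward T (c n 1) v]
        else if n + 1 ≤ 2 * m then ![stepToward T (c n 0) a, c n 1]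
        else ![c n 0, pursue T (observationLog vis S R n) (c n 1)] := by
      intro n
      rw [hmove n, ← length_observationLog (vis := vis) (S := S) (R := R) n]
      refine if_neg ?_
      rintro ⟨s, hs, hs'⟩
      rw [getLast?_observationLog, Option.some_inj] at hs
      rw [eq_robPos_of_observation_eq_some hs] at hs'
      exact hleft hs'
    have first_walk : ∀ n ≤ m, c n 0 = u ∧ T.dist (c n 1) v ≤ m - n ∧ Between T u v (r n) := by
      intro n
      induction n with
      | zero =>
        exact fun _ => ⟨rfl, hbv, (between_or_between_of_adj hT huv _).resolve_left hleft⟩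
      | succ n ih =>
        intro hn
        obtain ⟨h0, h1, h2⟩ := ih (by omega)
        have hmn := hmv n
        rw [if_pos hn] at hmn
        have hu : c (n + 1) 0 = u := by rw [hmn]; exact h0
        refine ⟨hu, ?_, ?_⟩
        · rw [hmn]
          change T.dist (stepToward T (c n 1) v) v ≤ _
          rw [dist_stepToward hT.connected]
          omega
        · refine (between_or_between_of_adj hT huv _).resolve_left fun h => ?_
          have hne : r (n + 1) ≠ u := fun h => (hcap (n + 1) 0).1 (by rw [hu]; exact h.symm)
          exact not_between_of_between_of_adj huv h2
            (h.of_eq_or_adj hT hne ((hrob n).imp Eq.symm Adj.symm))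
    have second_walk : ∀ n ≤ m, c (m + n) 1 = v ∧ T.dist (c (m + n) 0) a ≤ m - n ∧
        Between T u v (r (m + n)) := by
      intro n
      induction n with
      | zero =>
        obtain ⟨h0, h1, h2⟩ := first_walk m le_rfl
        refine fun _ => ⟨hT.connected.dist_eq_zero_iff.1 (by simpa using h1), ?_, h2⟩
        rw [add_zero, h0]
        exact hua
      | succ n ih =>
        intro hn
        obtain ⟨h0, h1, h2⟩ := ih (by omega)
        have hmn := hmv (m + n)
        rw [if_neg (by omega), if_pos (by omega)] at hmn
        rw [← add_assoc]
        refine ⟨by rw [hmn]; exact h0, ?_, ?_⟩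
        · rw [hmn]
          change T.dist (stepToward T (c (m + n) 0) a) a ≤ _
          rw [dist_stepToward hT.connected]
          omega
        · have hne : r (m + n) ≠ v := fun h => (hcap (m + n) 1).1 (by rw [h0]; exact h.symm)
          exact h2.of_eq_or_adj hT hne (hrob _)
    obtain ⟨h1, h0, hb⟩ := second_walk m le_rfl
    rw [Nat.sub_self, Nat.le_zero, hT.connected.dist_eq_zero_iff] at h0
    have hmv' : ∀ n, c (m + m + n + 1) =
        ![c (m + m + n) 0, pursue T (observationLog vis S R (m + m + n)) (c (m + m + n) 1)] := by
      intro n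
      rw [hmv, if_neg (by omega), if_neg (by omega)]
    have ha : ∀ n, c (m + m + n) 0 = a := by
      intro n
      induction n with
      | zero => exact h0
      | succ n ih => rw [← add_assoc, hmv' n]; exact ih
    obtain ⟨n, hn⟩ := pursuit_captures hT (k := k) (q := a) (x := fun n => c (m + m + n) 1)
      (r := fun n => r (m + m + n)) (fun n => hrob (m + m + n))
      (fun n hd => by
        simp only [← add_assoc, hmv' n]
        exact hpursue _ 0 _ (by rwa [ha n]))
      (by
        simp only [add_zero, h1]
        exact hauv.trans_of_ne hT hb huv.ne.symm)
      (by simpa only [add_zero, h1] using hav)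
    exact hn.elim (hcap _ 1).1 (hcap _ 1).2

/-- If `k ≥ 1` and `T` is a finite tree with `diam(T) ≥ 2k - 1`, then `c_{H,k}(T) ≤ 2`. -/
theorem stmt17 {V : Type} [Fintype V] (T : SimpleGraph V) (hT : T.IsTree)
    (k : ℕ) (hk : 1 ≤ k) (hdiam : 2 * k - 1 ≤ T.diam) :
    hyperopicCopNumber T k ≤ 2 := by
  obtain ⟨a, u, v, b, huv, hav, hbu, hauv, hbvu⟩ := exists_edge_on_longest_path hT hk hdiam
  refine Nat.sInf_le ⟨edgeStrategy T (max (T.dist u a) (T.dist b v)) a u v b,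
    edgeStrategy_legal _ _ _ _ _ _, fun R hR => ?_⟩
  refine edgeStrategy_captures hT huv (le_max_left ..) (le_max_right ..) hav hbu hauv hbvu ?_ hR
  intro c r i hd h
  have := (h i).2
  rw [T.dist_comm] at this
  omega

end CopsRobber
end

section
/- Let T be a finite tree, let x and y be vertices of T with d(x,y) = d, and let k ≥ 0 be an integer. If u and w are vertices of T satisfying d(u,x) ≤ k, d(u,y) ≤ k, d(w,x) ≤ k and d(w,y) ≤ k, then d(u,w) ≤ 2k − d. -/
namespace CopsRobber

open SimpleGraph

theorem _root_.SimpleGraph.IsTree.length_eq_dist_of_isPath {V : Type*} {G : SimpleGraph V}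
    (hG : G.IsTree) {u v : V} {p : G.Walk u v} (hp : p.IsPath) : p.length = G.dist u v := by
  obtain ⟨q, hq, hql⟩ := hG.connected.exists_path_of_dist u v
  rw [← hql, (hG.existsUnique_path u v).unique hp hq]

theorem _root_.SimpleGraph.IsTree.dist_add_dist_of_mem_support {V : Type*} {G : SimpleGraph V}
    (hG : G.IsTree) {u v m : V} {p : G.Walk u v} (hp : p.IsPath) (hm : m ∈ p.support) :
    G.dist u m + G.dist m v = G.dist u v := by
  classical
  rw [← hG.length_eq_dist_of_isPath hp, ← hG.length_eq_dist_of_isPath (hp.takeUntil hm),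
    ← hG.length_eq_dist_of_isPath (hp.dropUntil hm), ← Walk.length_append, Walk.take_spec]

/-- If `m` is a vertex closest to `x` on a path starting at `u` in a tree, then `m` lies between
`u` and `x`. -/
theorem _root_.SimpleGraph.IsTree.dist_add_dist_of_forall_dist_le {V : Type*} {G : SimpleGraph V}
    (hG : G.IsTree) {u v m x : V} {p : G.Walk u v} (hp : p.IsPath) (hm : m ∈ p.support)
    (hmin : ∀ z ∈ p.support, G.dist m x ≤ G.dist z x) :
    G.dist u m + G.dist m x = G.dist u x := by
  classical
  obtain ⟨q, hq, -⟩ := hG.connected.exists_path_of_dist m x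
  have happ : ((p.takeUntil m hm).append q).IsPath := by
    refine Walk.IsPath.mk' ?_
    have hq_nodup := hq.support_nodup
    rw [← Walk.cons_tail_support, List.nodup_cons] at hq_nodup
    rw [Walk.support_append, List.nodup_append']
    refine ⟨(hp.takeUntil hm).support_nodup, hq_nodup.2, fun z hz hzq ↦ ?_⟩
    have hne : m ≠ z := fun h ↦ hq_nodup.1 (h ▸ hzq)
    have hpos := hG.connected.pos_dist_of_ne hne
    have hsum := hG.dist_add_dist_of_mem_support hq (List.mem_of_mem_tail hzq)
    have hle := hmin z (p.support_takeUntil_subset_support hm hz)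
    omega
  exact hG.dist_add_dist_of_mem_support happ
    (Walk.mem_support_append_iff _ _ |>.mpr (Or.inr q.start_mem_support))

/-- The four-point condition for the distance in a tree. -/
theorem _root_.SimpleGraph.IsTree.dist_add_dist_le_max {V : Type*} {G : SimpleGraph V}
    (hG : G.IsTree) (u w x y : V) :
    G.dist u w + G.dist x y ≤ max (G.dist u x + G.dist w y) (G.dist u y + G.dist w x) := by
  classical
  obtain ⟨p, hp, -⟩ := hG.connected.exists_path_of_dist u w
  have gate (z : V) : ∃ m ∈ p.support, G.dist u m + G.dist m z = G.dist u z ∧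
      G.dist w m + G.dist m z = G.dist w z := by
    obtain ⟨m, hm, hmin⟩ := p.support.toFinset.exists_min_image (G.dist · z)
      ⟨u, List.mem_toFinset.mpr p.start_mem_support⟩
    simp only [List.mem_toFinset] at hm hmin
    exact ⟨m, hm, hG.dist_add_dist_of_forall_dist_le hp hm hmin,
      hG.dist_add_dist_of_forall_dist_le hp.reverse (by simpa using hm) (by simpa using hmin)⟩
  obtain ⟨m, hm, hum, hwm⟩ := gate x
  obtain ⟨n, hn, hun, hwn⟩ := gate y
  have hm' := hG.dist_add_dist_of_mem_support hp hm
  have hn' := hG.dist_add_dist_of_mem_support hp hn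
  have hxmy := hG.connected.dist_triangle (u := x) (v := m) (w := y)
  have hmny := hG.connected.dist_triangle (u := m) (v := n) (w := y)
  rw [G.dist_comm (u := x) (v := m)] at hxmy
  rw [G.dist_comm (u := w) (v := m)] at hwm
  rw [G.dist_comm (u := w) (v := n)] at hwn
  have hmem := hn
  rw [← Walk.take_spec p hm, Walk.mem_support_append_iff] at hmem
  rcases hmem with h | h
  · have := hG.dist_add_dist_of_mem_support (hp.takeUntil hm) h
    rw [G.dist_comm (u := n) (v := m)] at this
    omega
  · have := hG.dist_add_dist_of_mem_support (hp.dropUntil hm) h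
    omega

/-- In a finite tree `T`, if `d(x,y) = d` and `u, w` are vertices with
`d(u,x) ≤ k`, `d(u,y) ≤ k`, `d(w,x) ≤ k`, `d(w,y) ≤ k`, then `d(u,w) ≤ 2k - d`. -/
theorem stmt19 {V : Type} [Fintype V] (T : SimpleGraph V) (hT : T.IsTree)
    (x y u w : V) (d k : ℕ) (hxy : T.dist x y = d)
    (hux : T.dist u x ≤ k) (huy : T.dist u y ≤ k)
    (hwx : T.dist w x ≤ k) (hwy : T.dist w y ≤ k) :
    T.dist u w ≤ 2 * k - d := by
  have := hT.dist_add_dist_le_max u w x y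
  omega

end CopsRobber
end
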